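/- Suppose λ_m(A) > 0. Then there exist measurable functions φ_u, φ_s : Θ → 𝕋 which are (g,m)-invariant graphs (i.e. g_θ(φ_i(θ)) = φ_i(γθ) for m-a.e. θ, i = u,s), such that for m-a.e. θ ∈ Θ and every α ∈ 𝕋 with α ≠ φ_s(θ), the distance d(g^n_θ(α), φ_u(γ^n θ)) converges to 0 as n → ∞ with exponential speed. In particular, every (g,m)-invariant graph coincides m-a.e. with φ_u or with φ_s. -/

import Mathlib

open Filter MeasureTheory Metric Set
open scoped Topology

noncomputable section

/-- ℝ² with the Euclidean norm. -/
abbrev R2 : Type := EuclideanSpace ℝ (Fin 2)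

/-- Action of a 2×2 real matrix on Euclidean ℝ². -/
def mulVecE (M : Matrix (Fin 2) (Fin 2) ℝ) (v : R2) : R2 :=
  (WithLp.equiv 2 (Fin 2 → ℝ)).symm (M.mulVec ((WithLp.equiv 2 (Fin 2 → ℝ)) v))

/-- Operator norm of a 2×2 real matrix induced by the Euclidean norm on ℝ². -/
def opNorm (M : Matrix (Fin 2) (Fin 2) ℝ) : ℝ :=
  ‖(Matrix.toEuclideanCLM (𝕜 := ℝ) M : R2 →L[ℝ] R2)‖

/-- The cocycle `A_n(θ) = A(γ^{n-1}θ) ⋯ A(θ)`. -/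
def coc {Θ : Type*} (γ : Θ → Θ) (A : Θ → Matrix (Fin 2) (Fin 2) ℝ) :
    ℕ → Θ → Matrix (Fin 2) (Fin 2) ℝ
  | 0, _ => 1
  | n + 1, θ => coc γ A n (γ θ) * A θ

/-- Maximal Lyapunov exponent `λ_max(A) = sup_θ limsup (1/n) log‖A_n(θ)‖`. -/
def lyapMax {Θ : Type*} (γ : Θ → Θ) (A : Θ → Matrix (Fin 2) (Fin 2) ℝ) : ℝ :=
  ⨆ θ : Θ, Filter.limsup (fun n : ℕ => Real.log (opNorm (coc γ A n θ)) / n) Filter.atTop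

/-- The hypotheses on `h`: C² on [0,∞), strictly increasing, strictly concave, bounded,
nonnegative, `h 0 = 0`, `h' 0 = 1`. -/
def GoodH (h : ℝ → ℝ) : Prop :=
  ContDiffOn ℝ 2 h (Set.Ici 0) ∧ StrictMonoOn h (Set.Ici 0) ∧
    StrictConcaveOn ℝ (Set.Ici 0) h ∧ BddAbove (h '' Set.Ici 0) ∧
    (∀ x ∈ Set.Ici (0 : ℝ), 0 ≤ h x) ∧ h 0 = 0 ∧ derivWithin h (Set.Ici 0) 0 = 1

/-- The scaling condition `sup_{x ≥ 0} h(x) ≤ (sup_θ ‖A(θ)‖)⁻¹`. -/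
def Scaled {Θ : Type*} (A : Θ → Matrix (Fin 2) (Fin 2) ℝ) (h : ℝ → ℝ) : Prop :=
  ∀ x ∈ Set.Ici (0 : ℝ), h x ≤ (⨆ θ : Θ, opNorm (A θ))⁻¹

open scoped Classical in
/-- The fibre maps `f_{β,θ}(v) = h(β‖v‖)·A(θ)·v/‖v‖`, `f_{β,θ}(0) = 0`. -/
def fibMap {Θ : Type*} (A : Θ → Matrix (Fin 2) (Fin 2) ℝ) (h : ℝ → ℝ) (β : ℝ)
    (θ : Θ) (v : R2) : R2 :=
  if v = 0 then 0 else (h (β * ‖v‖) / ‖v‖) • mulVecE (A θ) v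

/-- The skew product `f_β(θ,v) = (γθ, f_{β,θ}(v))`. -/
def skewProd {Θ : Type*} (γ : Θ → Θ) (A : Θ → Matrix (Fin 2) (Fin 2) ℝ) (h : ℝ → ℝ)
    (β : ℝ) : Θ × R2 → Θ × R2 :=
  fun p => (γ p.1, fibMap A h β p.1 p.2)

/-- The global attractor `𝒜_β = ⋂_{n∈ℕ} f_β^n(Θ × B̄₁(0))`. -/
def globalAttractor {Θ : Type*} (γ : Θ → Θ) (A : Θ → Matrix (Fin 2) (Fin 2) ℝ)
    (h : ℝ → ℝ) (β : ℝ) : Set (Θ × R2) :=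
  ⋂ n : ℕ, (skewProd γ A h β)^[n] '' (Set.univ ×ˢ Metric.closedBall (0 : R2) 1)

/-- The fibre `𝒜_β(θ) = {x : (θ,x) ∈ 𝒜_β}` of the global attractor. -/
def attractorFib {Θ : Type*} (γ : Θ → Θ) (A : Θ → Matrix (Fin 2) (Fin 2) ℝ)
    (h : ℝ → ℝ) (β : ℝ) (θ : Θ) : Set R2 :=
  {x : R2 | (θ, x) ∈ globalAttractor γ A h β}

/-- `v(α) = (cos 2πα, sin 2πα)ᵗ`. -/
def vFull (α : ℝ) : R2 :=
  (WithLp.equiv 2 (Fin 2 → ℝ)).symm ![Real.cos (2 * Real.pi * α), Real.sin (2 * Real.pi * α)]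

/-- `(cos πα, sin πα)ᵗ`, representing the projective point `α ∈ 𝕋 ≅ ℝP¹`. -/
def vHalf (α : ℝ) : R2 :=
  (WithLp.equiv 2 (Fin 2 → ℝ)).symm ![Real.cos (Real.pi * α), Real.sin (Real.pi * α)]

/-- The projective angle coordinate `p(w) = (1/π)·arg(w) mod 1 ∈ [0,1)` of a nonzero
vector `w ∈ ℝ²`; for `w ≠ 0` this equals `(1/π)·arctan(w₂/w₁) mod 1`. -/
def projAngle (w : R2) : ℝ :=
  Int.fract (Complex.arg (Complex.ofReal (w 0) + Complex.ofReal (w 1) * Complex.I) / Real.pi)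

/-- The projective action `g(θ,α) = (γθ, g_θ(α))` of the cocycle on `Θ × 𝕋`,
where `𝕋` is modelled by the fundamental domain `[0,1) ⊆ ℝ`. -/
def gMap {Θ : Type*} (γ : Θ → Θ) (A : Θ → Matrix (Fin 2) (Fin 2) ℝ) :
    Θ × ℝ → Θ × ℝ :=
  fun p => (γ p.1, projAngle (mulVecE (A p.1) (vHalf p.2)))

/-- `Ω(θ,α) = ‖A(θ)(cos πα, sin πα)ᵗ‖`. -/
def Omega {Θ : Type*} (A : Θ → Matrix (Fin 2) (Fin 2) ℝ) (p : Θ × ℝ) : ℝ :=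
  ‖mulVecE (A p.1) (vHalf p.2)‖

/-- The fibre maps `F_{β,θ,α}(r) = h(βr)·Ω(θ,α)` of the double skew product. -/
def dsFib {Θ : Type*} (A : Θ → Matrix (Fin 2) (Fin 2) ℝ) (h : ℝ → ℝ) (β : ℝ)
    (p : Θ × ℝ) (r : ℝ) : ℝ :=
  h (β * r) * Omega A p

/-- The double skew product `F_β(θ,α,r) = (g(θ,α), h(βr)·Ω(θ,α))` on `Θ × 𝕋 × [0,∞)`. -/
def dsMap {Θ : Type*} (γ : Θ → Θ) (A : Θ → Matrix (Fin 2) (Fin 2) ℝ) (h : ℝ → ℝ)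
    (β : ℝ) : Θ × ℝ × ℝ → Θ × ℝ × ℝ :=
  fun p => ((gMap γ A (p.1, p.2.1)).1, (gMap γ A (p.1, p.2.1)).2, dsFib A h β (p.1, p.2.1) p.2.2)

/-- `Ω_n(θ,α) = ∏_{i=0}^{n-1} Ω(g^i(θ,α))`. -/
def OmegaProd {Θ : Type*} (γ : Θ → Θ) (A : Θ → Matrix (Fin 2) (Fin 2) ℝ) (n : ℕ)
    (p : Θ × ℝ) : ℝ :=
  ∏ i ∈ Finset.range n, Omega A ((gMap γ A)^[i] p)

/-- `Γ(a,b) = inf_{a ≤ x ≤ 1} inf_{0 < q ≤ b} h(qx)/(q·h(x))`. -/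
def GammaH (h : ℝ → ℝ) (a b : ℝ) : ℝ :=
  sInf {y : ℝ | ∃ x ∈ Set.Icc a 1, ∃ q ∈ Set.Ioc (0 : ℝ) b, y = h (q * x) / (q * h x)}

/-- The inverse `g⁻¹(θ,α) = (γ⁻¹θ, projective angle of A(γ⁻¹θ)⁻¹·v(α))` of the
projective action. -/
def gInv {Θ : Type*} (γinv : Θ → Θ) (A : Θ → Matrix (Fin 2) (Fin 2) ℝ) :
    Θ × ℝ → Θ × ℝ :=
  fun p => (γinv p.1, projAngle (mulVecE (A (γinv p.1))⁻¹ (vHalf p.2)))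

/-- `F^n_{β,g^{-n}(θ,α)}(1)`, the pullback iterate defining the upper bounding graph. -/
def pullback1 {Θ : Type*} (γ : Θ → Θ) (γinv : Θ → Θ) (A : Θ → Matrix (Fin 2) (Fin 2) ℝ)
    (h : ℝ → ℝ) (β : ℝ) (n : ℕ) (p : Θ × ℝ) : ℝ :=
  ((dsMap γ A h β)^[n] (((gInv γinv A)^[n] p).1, ((gInv γinv A)^[n] p).2, 1)).2.2

section ProjectiveLine

/-- The linear action of a real `2 × 2` matrix on `ℂ ≅ ℝ²`. -/
def actC (M : Matrix (Fin 2) (Fin 2) ℝ) (z : ℂ) : ℂ :=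
  ⟨M 0 0 * z.re + M 0 1 * z.im, M 1 0 * z.re + M 1 1 * z.im⟩

/-- The determinant of two plane vectors. -/
def wedge (z w : ℂ) : ℝ := z.re * w.im - z.im * w.re

/-- The unit vector representing the projective point `α`. -/
def dir (α : ℝ) : ℂ := ⟨Real.cos (Real.pi * α), Real.sin (Real.pi * α)⟩

/-- The projective angle of a plane vector. -/
def ang (z : ℂ) : ℝ := Int.fract (Complex.arg z / Real.pi)

/-- The Frobenius norm. -/
def fro (M : Matrix (Fin 2) (Fin 2) ℝ) : ℝ :=
  Real.sqrt (M 0 0 ^ 2 + M 0 1 ^ 2 + M 1 0 ^ 2 + M 1 1 ^ 2)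

variable {M N : Matrix (Fin 2) (Fin 2) ℝ}

lemma sq_norm_eq (z : ℂ) : ‖z‖ ^ 2 = z.re ^ 2 + z.im ^ 2 := by
  rw [Complex.sq_norm, Complex.normSq_apply]; ring

lemma sq_fro (M : Matrix (Fin 2) (Fin 2) ℝ) :
    fro M ^ 2 = M 0 0 ^ 2 + M 0 1 ^ 2 + M 1 0 ^ 2 + M 1 1 ^ 2 :=
  Real.sq_sqrt (by positivity)

lemma fro_nonneg (M : Matrix (Fin 2) (Fin 2) ℝ) : 0 ≤ fro M := Real.sqrt_nonneg _

lemma one_le_fro (h : M.det = 1) : 1 ≤ fro M := by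
  rw [Matrix.det_fin_two] at h
  have h2 := sq_fro M
  nlinarith [sq_nonneg (M 0 0 - M 1 1), sq_nonneg (M 0 1 + M 1 0), fro_nonneg M]

lemma actC_mul (M N : Matrix (Fin 2) (Fin 2) ℝ) (z : ℂ) :
    actC (M * N) z = actC M (actC N z) := by
  apply Complex.ext <;> simp [actC, Matrix.mul_apply, Fin.sum_univ_two] <;> ring

lemma actC_one (z : ℂ) : actC 1 z = z := by
  apply Complex.ext <;> simp [actC]

lemma actC_smul (M : Matrix (Fin 2) (Fin 2) ℝ) (r : ℝ) (z : ℂ) :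
    actC M (r • z) = r • actC M z := by
  apply Complex.ext <;> simp [actC] <;> ring

lemma actC_add (M : Matrix (Fin 2) (Fin 2) ℝ) (z w : ℂ) :
    actC M (z + w) = actC M z + actC M w := by
  apply Complex.ext <;> simp [actC] <;> ring

lemma norm_actC_le (M : Matrix (Fin 2) (Fin 2) ℝ) (z : ℂ) : ‖actC M z‖ ≤ fro M * ‖z‖ := by
  apply le_of_sq_le_sq _ (mul_nonneg (fro_nonneg M) (norm_nonneg z))
  rw [mul_pow, sq_norm_eq, sq_norm_eq, sq_fro]
  simp only [actC]
  nlinarith [sq_nonneg (M 0 0 * z.im - M 0 1 * z.re), sq_nonneg (M 1 0 * z.im - M 1 1 * z.re)]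

lemma fro_mul_le (M N : Matrix (Fin 2) (Fin 2) ℝ) : fro (M * N) ≤ fro M * fro N := by
  apply le_of_sq_le_sq _ (mul_nonneg (fro_nonneg M) (fro_nonneg N))
  rw [mul_pow, sq_fro, sq_fro, sq_fro]
  simp only [Matrix.mul_apply, Fin.sum_univ_two]
  nlinarith [sq_nonneg (M 0 0 * N 1 0 - M 0 1 * N 0 0), sq_nonneg (M 0 0 * N 1 1 - M 0 1 * N 0 1),
    sq_nonneg (M 1 0 * N 1 0 - M 1 1 * N 0 0), sq_nonneg (M 1 0 * N 1 1 - M 1 1 * N 0 1)]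

lemma fro_inv (h : M.det = 1) : fro M⁻¹ = fro M := by
  have : M⁻¹ = M.adjugate := by rw [Matrix.inv_def, h]; simp
  unfold fro
  rw [this, Matrix.adjugate_fin_two]
  congr 1
  simp
  ring

lemma det_inv_eq_one (h : M.det = 1) : M⁻¹.det = 1 := by
  rw [Matrix.det_nonsing_inv, h]; simp

lemma actC_inv_actC (h : M.det = 1) (z : ℂ) : actC M⁻¹ (actC M z) = z := by
  rw [← actC_mul, Matrix.nonsing_inv_mul _ (by simp [h]), actC_one]

lemma actC_actC_inv (h : M.det = 1) (z : ℂ) : actC M (actC M⁻¹ z) = z := by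
  rw [← actC_mul, Matrix.mul_nonsing_inv _ (by simp [h]), actC_one]

lemma norm_le_fro_mul_norm_actC (h : M.det = 1) (z : ℂ) : ‖z‖ ≤ fro M * ‖actC M z‖ := by
  conv_lhs => rw [← actC_inv_actC h z]
  rw [← fro_inv h]
  exact norm_actC_le _ _

lemma actC_ne_zero (h : M.det = 1) {z : ℂ} (hz : z ≠ 0) : actC M z ≠ 0 := by
  intro h0
  have := norm_le_fro_mul_norm_actC h z
  rw [h0, norm_zero, mul_zero] at this
  exact hz (norm_le_zero_iff.1 this)

lemma wedge_actC (h : M.det = 1) (z w : ℂ) : wedge (actC M z) (actC M w) = wedge z w := by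
  rw [Matrix.det_fin_two] at h
  simp only [wedge, actC]
  linear_combination (z.re * w.im - z.im * w.re) * h

lemma abs_wedge_le (z w : ℂ) : |wedge z w| ≤ ‖z‖ * ‖w‖ := by
  apply abs_le_of_sq_le_sq _ (by positivity)
  rw [mul_pow, sq_norm_eq, sq_norm_eq, wedge]
  nlinarith [sq_nonneg (z.re * w.re + z.im * w.im)]

lemma wedge_smul_left (r : ℝ) (z w : ℂ) : wedge (r • z) w = r * wedge z w := by
  simp [wedge]; ring

lemma wedge_smul_right (r : ℝ) (z w : ℂ) : wedge z (r • w) = r * wedge z w := by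
  simp [wedge]; ring

lemma norm_sq_sub_sq {z w : ℂ} (hz : ‖z‖ = 1) (hw : ‖w‖ = 1) :
    ‖z ^ 2 - w ^ 2‖ = 2 * |wedge z w| := by
  have hz' := sq_norm_eq z
  have hw' := sq_norm_eq w
  rw [hz] at hz'
  rw [hw] at hw'
  rw [← abs_of_nonneg (norm_nonneg (z ^ 2 - w ^ 2)), ← abs_of_pos (two_pos : (0 : ℝ) < 2),
    ← abs_mul, ← sq_eq_sq_iff_abs_eq_abs, sq_norm_eq]
  simp only [wedge, pow_two, Complex.sub_re, Complex.sub_im, Complex.mul_re, Complex.mul_im]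
  have hz2 : z.im ^ 2 = 1 - z.re ^ 2 := by linarith
  have hw2 : w.im ^ 2 = 1 - w.re ^ 2 := by linarith
  have e1 : (z.re ^ 2 + z.im ^ 2) ^ 2 = 1 := by rw [← hz']; norm_num
  have e2 : (w.re ^ 2 + w.im ^ 2) ^ 2 = 1 := by rw [← hw']; norm_num
  have e3 : (z.re ^ 2 + z.im ^ 2) * (w.re ^ 2 + w.im ^ 2) = 1 := by rw [← hz', ← hw']; norm_num
  linear_combination e1 + e2 - 2 * e3

lemma norm_dir (α : ℝ) : ‖dir α‖ = 1 := by
  rw [← sq_eq_sq₀ (norm_nonneg _) zero_le_one, sq_norm_eq]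
  simp [dir]

lemma dir_ne_zero (α : ℝ) : dir α ≠ 0 := by
  rw [← norm_pos_iff, norm_dir]; exact one_pos

lemma wedge_dir (α β : ℝ) : wedge (dir α) (dir β) = Real.sin (Real.pi * (β - α)) := by
  simp only [wedge, dir]
  rw [mul_sub, Real.sin_sub]; ring

lemma two_mul_dist_le_abs_wedge (α β : ℝ) :
    2 * dist (α : AddCircle (1 : ℝ)) (β : AddCircle (1 : ℝ)) ≤ |wedge (dir α) (dir β)| := by
  have hd : dist (α : AddCircle (1 : ℝ)) (β : AddCircle (1 : ℝ))
      = |(β - α) - round (β - α)| := by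
    rw [dist_comm, dist_eq_norm, ← AddCircle.coe_sub, AddCircle.norm_eq]
    simp
  rw [hd, wedge_dir]
  set x := β - α
  set y := x - round x with hy
  have hsin : |Real.sin (Real.pi * x)| = |Real.sin (Real.pi * |y|)| := by
    have : Real.pi * x = Real.pi * y + (round x : ℤ) * Real.pi := by rw [hy]; ring
    rw [this, Real.sin_add_int_mul_pi]
    rcases abs_cases y with h | h
    · rw [h.1, abs_mul]; simp
    · rw [h.1, abs_mul]; simp
  have hy2 : |y| ≤ 1 / 2 := abs_sub_round x
  rw [hsin]
  refine le_trans ?_ (le_abs_self _)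
  have := Real.mul_le_sin (x := Real.pi * |y|) (by positivity) (by nlinarith [Real.pi_pos])
  refine le_trans (le_of_eq ?_) this
  field_simp

lemma coe_eq_coe_of_wedge_eq_zero {α β : ℝ} (h : wedge (dir α) (dir β) = 0) :
    (α : AddCircle (1 : ℝ)) = β := by
  have := two_mul_dist_le_abs_wedge α β
  rw [h, abs_zero] at this
  exact dist_le_zero.1 (by linarith)

lemma eq_of_coe_eq_coe {α β : ℝ} (hα : α ∈ Ico (0 : ℝ) 1) (hβ : β ∈ Ico (0 : ℝ) 1)
    (h : (α : AddCircle (1 : ℝ)) = β) : α = β := by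
  have : Fact ((0 : ℝ) < 1) := ⟨one_pos⟩
  exact (AddCircle.coe_eq_coe_iff_of_mem_Ico (a := 0) (by simpa using hα)
    (by simpa using hβ)).1 h

lemma dir_fract (x : ℝ) : ∃ ε : ℝ, |ε| = 1 ∧ dir (Int.fract x) = ε • dir x := by
  refine ⟨(-1) ^ ⌊x⌋, by simp, ?_⟩
  have : Real.pi * Int.fract x = Real.pi * x - ⌊x⌋ * Real.pi := by rw [Int.fract]; ring
  apply Complex.ext <;>
    simp only [dir, this, Real.sin_sub_int_mul_pi, Real.cos_sub_int_mul_pi, Complex.smul_re,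
      Complex.smul_im, smul_eq_mul]

lemma ang_mem (z : ℂ) : ang z ∈ Ico (0 : ℝ) 1 := ⟨Int.fract_nonneg _, Int.fract_lt_one _⟩

lemma dir_ang {z : ℂ} (hz : z ≠ 0) : ∃ r : ℝ, r ≠ 0 ∧ dir (ang z) = r • z := by
  obtain ⟨ε, hε, h⟩ := dir_fract (Complex.arg z / Real.pi)
  have hε0 : ε ≠ 0 := by rintro rfl; simp at hε
  refine ⟨ε * ‖z‖⁻¹, mul_ne_zero hε0 (by simpa using hz), ?_⟩
  rw [ang, h, mul_smul]
  congr 1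
  have : Real.pi * (z.arg / Real.pi) = z.arg := by field_simp
  apply Complex.ext
  · simp [dir, this, Complex.cos_arg hz]; ring
  · simp [dir, this, Complex.sin_arg]; ring

lemma ang_eq_of_wedge_eq_zero {z : ℂ} (hz : z ≠ 0) {α : ℝ} (hα : α ∈ Ico (0 : ℝ) 1)
    (h : wedge (dir α) z = 0) : ang z = α := by
  obtain ⟨r, -, hr⟩ := dir_ang hz
  refine (eq_of_coe_eq_coe hα (ang_mem z) (coe_eq_coe_of_wedge_eq_zero ?_)).symm
  rw [hr, wedge_smul_right, h, mul_zero]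

lemma wedge_eq_zero_of_ang_eq {z : ℂ} (hz : z ≠ 0) {α : ℝ} (h : ang z = α) :
    ∃ r : ℝ, r ≠ 0 ∧ z = r • dir α := by
  obtain ⟨r, hr0, hr⟩ := dir_ang hz
  exact ⟨r⁻¹, inv_ne_zero hr0, by rw [← h, hr, smul_smul, inv_mul_cancel₀ hr0, one_smul]⟩

/-- A vector that is almost maximally contracted by a matrix of determinant one. -/
def contr (M : Matrix (Fin 2) (Fin 2) ℝ) : ℂ :=
  if M 0 0 ^ 2 + M 0 1 ^ 2 ≤ M 1 0 ^ 2 + M 1 1 ^ 2 then ⟨M 1 1, -M 1 0⟩ else ⟨-M 0 1, M 0 0⟩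

lemma fro_le_two_mul_norm_contr (M : Matrix (Fin 2) (Fin 2) ℝ) : fro M ≤ 2 * ‖contr M‖ := by
  apply le_of_sq_le_sq _ (by positivity)
  rw [mul_pow, sq_norm_eq, sq_fro, contr]
  split_ifs with h
  · simp only
    nlinarith [sq_nonneg (M 1 0), sq_nonneg (M 1 1)]
  · simp only
    nlinarith [sq_nonneg (M 0 0), sq_nonneg (M 0 1)]

lemma norm_actC_contr (h : M.det = 1) : ‖actC M (contr M)‖ = 1 := by
  rw [← sq_eq_sq₀ (norm_nonneg _) zero_le_one, sq_norm_eq]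
  rw [Matrix.det_fin_two] at h
  unfold contr
  split_ifs
  · have h1 : M 0 0 * M 1 1 + M 0 1 * -M 1 0 = 1 := by linarith
    have h2 : M 1 0 * M 1 1 + M 1 1 * -M 1 0 = 0 := by ring
    simp only [actC, h1, h2]; norm_num
  · have h1 : M 0 0 * -M 0 1 + M 0 1 * M 0 0 = 0 := by ring
    have h2 : M 1 0 * -M 0 1 + M 1 1 * M 0 0 = 1 := by linarith
    simp only [actC, h1, h2]; norm_num

/-- The normalization of `contr`. -/
def contrUnit (M : Matrix (Fin 2) (Fin 2) ℝ) : ℂ := ‖contr M‖⁻¹ • contr M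

lemma norm_contr_pos (h : M.det = 1) : 0 < ‖contr M‖ := by
  linarith [one_le_fro h, fro_le_two_mul_norm_contr M]

lemma norm_contrUnit (h : M.det = 1) : ‖contrUnit M‖ = 1 := by
  rw [contrUnit, norm_smul, norm_inv, norm_norm, inv_mul_cancel₀ (norm_contr_pos h).ne']

lemma norm_actC_contrUnit_le (h : M.det = 1) : ‖actC M (contrUnit M)‖ ≤ 2 / fro M := by
  rw [contrUnit, actC_smul, norm_smul, norm_actC_contr h, norm_inv, norm_norm, mul_one,
    le_div_iff₀ (by linarith [one_le_fro h]), inv_mul_le_iff₀ (norm_contr_pos h)]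
  linarith [fro_le_two_mul_norm_contr M]

lemma abs_wedge_contrUnit_le (h : M.det = 1) (v : ℂ) :
    |wedge v (contrUnit M)| ≤ 2 * ‖actC M v‖ / fro M := by
  rw [← wedge_actC h]
  refine (abs_wedge_le _ _).trans ?_
  calc _ ≤ ‖actC M v‖ * (2 / fro M) := by gcongr; exact norm_actC_contrUnit_le h
    _ = _ := by ring

lemma abs_wedge_contrUnit_contrUnit_le (hM : M.det = 1) (hN : N.det = 1) :
    |wedge (contrUnit M) (contrUnit (N * M))| ≤ 4 * fro N ^ 2 / fro M ^ 2 := by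
  have hNM : (N * M).det = 1 := by rw [Matrix.det_mul, hM, hN, one_mul]
  have hM0 := one_le_fro hM
  have hN0 := one_le_fro hN
  have hNM0 := one_le_fro hNM
  have h1 : ‖actC M (contrUnit (N * M))‖ ≤ fro N * (2 / fro (N * M)) := by
    refine (norm_le_fro_mul_norm_actC hN _).trans ?_
    rw [← actC_mul]
    gcongr
    exact norm_actC_contrUnit_le hNM
  have h2 : fro M ≤ fro N * fro (N * M) := by
    have := fro_mul_le N⁻¹ (N * M)
    rwa [← Matrix.mul_assoc, Matrix.nonsing_inv_mul _ (by simp [hN]), Matrix.one_mul,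
      fro_inv hN] at this
  have h3 : 2 / fro (N * M) ≤ 2 * fro N / fro M := by
    rw [div_le_div_iff₀ (by linarith) (by linarith)]; nlinarith
  rw [← wedge_actC hM]
  refine (abs_wedge_le _ _).trans ?_
  calc _ ≤ (2 / fro M) * (fro N * (2 * fro N / fro M)) := by
        gcongr
        · exact norm_actC_contrUnit_le hM
        · exact h1.trans (by gcongr)
    _ = _ := by field_simp; norm_num

lemma norm_actC_le_of_contrUnit (h : M.det = 1) {v : ℂ} (hv : ‖v‖ = 1) :
    ‖actC M v‖ ≤ 2 / fro M + fro M * |wedge v (contrUnit M)| := by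
  set s := contrUnit M with hs
  have hs1 : ‖s‖ = 1 := norm_contrUnit h
  have hs2 := sq_norm_eq s
  rw [hs1] at hs2
  have hdec : v = (v.re * s.re + v.im * s.im) • s + (-wedge v s) • (⟨-s.im, s.re⟩ : ℂ) := by
    apply Complex.ext
    · simp [wedge]; linear_combination v.re * hs2
    · simp [wedge]; linear_combination v.im * hs2
  have hi : ‖(⟨-s.im, s.re⟩ : ℂ)‖ = 1 := by
    rw [← sq_eq_sq₀ (norm_nonneg _) zero_le_one, sq_norm_eq]
    simp only; linarith
  have hin : |v.re * s.re + v.im * s.im| ≤ 1 := by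
    have hv2 := sq_norm_eq v
    rw [hv] at hv2
    rw [abs_le]
    constructor <;> nlinarith [sq_nonneg (v.re - s.re), sq_nonneg (v.im - s.im),
      sq_nonneg (v.re + s.re), sq_nonneg (v.im + s.im)]
  conv_lhs => rw [hdec]
  rw [actC_add, actC_smul, actC_smul]
  refine (norm_add_le _ _).trans ?_
  rw [norm_smul, norm_smul, Real.norm_eq_abs, Real.norm_eq_abs, abs_neg]
  have h1 := norm_actC_contrUnit_le h
  have h2 := norm_actC_le M ⟨-s.im, s.re⟩
  rw [hi, mul_one] at h2
  rw [mul_comm (fro M)]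
  refine add_le_add ?_ (by gcongr)
  calc _ ≤ 1 * ‖actC M s‖ := by gcongr
    _ ≤ _ := by rw [one_mul]; exact h1

end ProjectiveLine

section Covering

variable {Θ : Type*} {T : Θ → Θ} {f : ℕ → Θ → ℝ} {K : ℝ}

lemma birkhoffSum_nonneg {g : Θ → ℝ} (hg : ∀ θ, 0 ≤ g θ) (n : ℕ) (θ : Θ) :
    0 ≤ birkhoffSum T g n θ :=
  Finset.sum_nonneg fun _ _ => hg _

/-- If a subadditive sequence is nonpositive at some time in `[1, N]` outside a bad set, then it
is controlled by the number of visits to the bad set. -/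
lemma le_birkhoffSum_of_subadditive (hK : 0 ≤ K) (hf : ∀ n θ, f n θ ≤ K * (n + 1))
    (hsub : ∀ a b θ, f (a + b) θ ≤ f a θ + f b (T^[a] θ)) (N n : ℕ) (θ : Θ) :
    f n θ ≤ 2 * K * birkhoffSum T
      ({θ | ∀ j, 1 ≤ j → j ≤ N → 0 < f j θ}.indicator fun _ => (1 : ℝ)) n θ + K * (N + 1) := by
  set B := {θ | ∀ j, 1 ≤ j → j ≤ N → 0 < f j θ}
  have hpos : ∀ θ, 0 ≤ B.indicator (fun _ => (1 : ℝ)) θ :=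
    fun θ => indicator_nonneg (fun _ _ => zero_le_one) θ
  have hK2 : 0 ≤ 2 * K := by linarith
  induction n using Nat.strong_induction_on generalizing θ with
  | _ n ih =>
  rcases le_or_gt n N with hn | hn
  · have h1 := mul_nonneg hK2 (birkhoffSum_nonneg (T := T) hpos n θ)
    have h2 : K * ((n : ℝ) + 1) ≤ K * (N + 1) := by gcongr
    linarith [hf n θ]
  by_cases hθ : θ ∈ B
  · obtain ⟨k, rfl⟩ : ∃ k, n = k + 1 := ⟨n - 1, by omega⟩
    have h1 := hsub 1 k θ
    have h2 := ih k (by omega) (T θ)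
    have h3 := hf 1 θ
    rw [birkhoffSum_succ', indicator_of_mem hθ]
    rw [add_comm 1 k] at h1
    simp only [Function.iterate_one] at h1
    push_cast at h3
    linarith
  · simp only [B, mem_ofPred_eq, not_forall, not_lt] at hθ
    obtain ⟨j, hj1, hjN, hj⟩ := hθ
    obtain ⟨k, rfl⟩ : ∃ k, n = j + k := ⟨n - j, by omega⟩
    have h1 := hsub j k θ
    have h2 := ih k (by omega) (T^[j] θ)
    have h3 := mul_nonneg hK2 (birkhoffSum_nonneg (T := T) hpos j θ)
    rw [birkhoffSum_add]
    linarith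

variable [MeasurableSpace Θ] {m : Measure Θ}

lemma integral_comp_measurePreserving (hT : MeasurePreserving T m m) {g : Θ → ℝ}
    (hg : AEStronglyMeasurable g m) : ∫ θ, g (T θ) ∂m = ∫ θ, g θ ∂m := by
  conv_rhs => rw [← hT.map_eq]
  rw [integral_map hT.measurable.aemeasurable]
  rwa [hT.map_eq]

lemma integral_birkhoffSum (hT : MeasurePreserving T m m) {g : Θ → ℝ} (hg : Integrable g m)
    (n : ℕ) : ∫ θ, birkhoffSum T g n θ ∂m = n * ∫ θ, g θ ∂m := by
  unfold birkhoffSum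
  have hk : ∀ k ∈ Finset.range n, Integrable (fun θ => g (T^[k] θ)) m :=
    fun k _ => (hT.iterate k).integrable_comp_of_integrable hg
  rw [integral_finsetSum _ hk]
  have : ∀ k, ∫ θ, g (T^[k] θ) ∂m = ∫ θ, g θ ∂m := fun k =>
    integral_comp_measurePreserving (hT.iterate k) hg.aestronglyMeasurable
  simp [this]

lemma integrable_birkhoffSum (hT : MeasurePreserving T m m) {g : Θ → ℝ} (hg : Integrable g m)
    (n : ℕ) : Integrable (birkhoffSum T g n) m :=
  integrable_finsetSum _ fun k _ => (hT.iterate k).integrable_comp_of_integrable hg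

/-- If a subadditive process is a.e. nonpositive at some positive time, then its mean growth rate
is nonpositive. -/
lemma growth_rate_nonpos [IsProbabilityMeasure m] (hT : MeasurePreserving T m m) (hK : 0 ≤ K)
    (hf : ∀ n θ, f n θ ≤ K * (n + 1)) (hsub : ∀ a b θ, f (a + b) θ ≤ f a θ + f b (T^[a] θ))
    (hmeas : ∀ n, Measurable (f n)) (hint : ∀ n, Integrable (f n) m)
    (h : ∀ᵐ θ ∂m, ∃ n, 1 ≤ n ∧ f n θ ≤ 0) {L : ℝ}
    (hL : Tendsto (fun n : ℕ => (∫ θ, f n θ ∂m) / n) atTop (𝓝 L)) : L ≤ 0 := by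
  set B : ℕ → Set Θ := fun N => {θ | ∀ j, 1 ≤ j → j ≤ N → 0 < f j θ}
  have hB : ∀ N, MeasurableSet (B N) := fun N => by
    simp only [B, ofPred_forall]
    exact MeasurableSet.iInter fun j => MeasurableSet.iInter fun _ => MeasurableSet.iInter fun _ =>
      measurableSet_lt measurable_const (hmeas j)
  have hanti : Antitone B := fun N N' hN θ hθ j h1 h2 => hθ j h1 (h2.trans hN)
  have hnull : m (⋂ N, B N) = 0 := by
    refine measure_mono_null (fun θ hθ => ?_) (ae_iff.1 h)
    rintro ⟨n, hn, hfn⟩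
    exact absurd (mem_iInter.1 hθ n n hn le_rfl) (not_lt.2 hfn)
  have hlim : Tendsto (fun N => m.real (B N)) atTop (𝓝 0) := by
    have := tendsto_measure_iInter_atTop (fun N => (hB N).nullMeasurableSet (μ := m)) hanti
      ⟨0, measure_ne_top _ _⟩
    rw [hnull] at this
    exact (ENNReal.tendsto_toReal ENNReal.zero_ne_top).comp this
  have hbound : ∀ N, L ≤ 2 * K * m.real (B N) := fun N => by
    have hind : Integrable ((B N).indicator fun _ => (1 : ℝ)) m :=
      (integrable_const _).indicator (hB N)
    have hmean : ∀ n : ℕ, ∫ θ, f n θ ∂m ≤ 2 * K * (n * m.real (B N)) + K * (N + 1) := fun n => by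
      calc ∫ θ, f n θ ∂m ≤ ∫ θ, (2 * K * birkhoffSum T ((B N).indicator fun _ => (1 : ℝ)) n θ
            + K * (N + 1)) ∂m := by
            refine integral_mono (hint n)
              (((integrable_birkhoffSum hT hind n).const_mul _).add (integrable_const _))
              fun θ => le_birkhoffSum_of_subadditive hK hf hsub N n θ
        _ = _ := by
            rw [integral_add ((integrable_birkhoffSum hT hind n).const_mul _)
              (integrable_const _), integral_const_mul, integral_birkhoffSum hT hind,
              integral_indicator_const _ (hB N)]
            simp
    have hlim2 : Tendsto (fun n : ℕ => 2 * K * m.real (B N) + K * (N + 1) / n) atTop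
        (𝓝 (2 * K * m.real (B N) + 0)) :=
      tendsto_const_nhds.add (tendsto_const_div_atTop_nhds_zero_nat _)
    rw [add_zero] at hlim2
    refine le_of_tendsto_of_tendsto hL hlim2 ?_
    filter_upwards [eventually_gt_atTop 0] with n hn
    have hn' : (0 : ℝ) < n := by exact_mod_cast hn
    rw [div_le_iff₀ hn', add_mul, div_mul_cancel₀ _ hn'.ne']
    linarith [hmean n]
  have := hlim.const_mul (2 * K)
  rw [mul_zero] at this
  exact ge_of_tendsto' this hbound

end Covering

section Cocycle

variable {Θ : Type*} {T : Θ → Θ} {A : Θ → Matrix (Fin 2) (Fin 2) ℝ} {C : ℝ}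

lemma coc_add (a b : ℕ) (θ : Θ) : coc T A (a + b) θ = coc T A b (T^[a] θ) * coc T A a θ := by
  induction a generalizing θ with
  | zero => simp [coc]
  | succ a ih =>
    rw [show a + 1 + b = (a + b) + 1 by ring, coc, ih, Function.iterate_succ_apply, coc,
      Matrix.mul_assoc]

lemma coc_one (θ : Θ) : coc T A 1 θ = A θ := by simp [coc]

lemma coc_succ' (n : ℕ) (θ : Θ) : coc T A (n + 1) θ = A (T^[n] θ) * coc T A n θ := by
  rw [coc_add, coc_one]

lemma det_coc (hdet : ∀ θ, (A θ).det = 1) (n : ℕ) (θ : Θ) : (coc T A n θ).det = 1 := by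
  induction n generalizing θ with
  | zero => simp [coc]
  | succ n ih => rw [coc, Matrix.det_mul, ih, hdet, one_mul]

lemma one_le_of_fro_le (hdet : ∀ θ, (A θ).det = 1) (hC : ∀ θ, fro (A θ) ≤ C) (θ : Θ) : 1 ≤ C :=
  (one_le_fro (hdet θ)).trans (hC θ)

lemma log_fro_nonneg {M : Matrix (Fin 2) (Fin 2) ℝ} (h : M.det = 1) : 0 ≤ Real.log (fro M) :=
  Real.log_nonneg (one_le_fro h)

lemma log_fro_mul_le {M N : Matrix (Fin 2) (Fin 2) ℝ} (hM : M.det = 1) (hN : N.det = 1) :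
    Real.log (fro (M * N)) ≤ Real.log (fro M) + Real.log (fro N) := by
  have h1 := one_le_fro hM
  have h2 := one_le_fro hN
  have h3 := one_le_fro (M := M * N) (by rw [Matrix.det_mul, hM, hN, one_mul])
  rw [← Real.log_mul (by positivity) (by positivity)]
  exact Real.log_le_log (by positivity) (fro_mul_le M N)

lemma log_fro_coc_le (hdet : ∀ θ, (A θ).det = 1) (hC : ∀ θ, fro (A θ) ≤ C) (n : ℕ) (θ : Θ) :
    Real.log (fro (coc T A n θ)) ≤ (Real.log C + Real.log 2) * (n + 1) := by
  have h0 : 0 ≤ Real.log C := Real.log_nonneg (one_le_of_fro_le hdet hC θ)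
  have h2 : 0 ≤ Real.log 2 := Real.log_nonneg one_le_two
  induction n generalizing θ with
  | zero =>
    have : fro (1 : Matrix (Fin 2) (Fin 2) ℝ) ≤ 2 :=
      Real.sqrt_le_iff.2 ⟨by norm_num, by norm_num⟩
    have h1 := Real.log_le_log (by linarith [one_le_fro (M := 1) (by simp)]) this
    simp only [coc]
    push_cast
    linarith
  | succ n ih =>
    have h1 := log_fro_mul_le (det_coc (T := T) hdet n (T θ)) (hdet θ)
    have h3 := Real.log_le_log (by linarith [one_le_fro (hdet θ)]) (hC θ)
    simp only [coc]
    push_cast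
    linarith [ih (T θ)]

lemma log_fro_coc_comp_le (hdet : ∀ θ, (A θ).det = 1) (hC : ∀ θ, fro (A θ) ≤ C) (n : ℕ) (θ : Θ) :
    Real.log (fro (coc T A n (T θ))) ≤ Real.log (fro (coc T A (n + 1) θ)) + Real.log C := by
  have h1 := log_fro_mul_le (det_coc (T := T) hdet (n + 1) θ) (det_inv_eq_one (hdet θ))
  have h3 := Real.log_le_log (by linarith [one_le_fro (hdet θ)]) (hC θ)
  rw [coc, Matrix.mul_assoc, Matrix.mul_nonsing_inv _ (by simp [hdet]), Matrix.mul_one,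
    fro_inv (hdet θ)] at h1
  simp only [coc]
  linarith

variable [MeasurableSpace Θ] {m : Measure Θ}

lemma measurable_coc (hT : Measurable T) (hA : ∀ i j, Measurable fun θ => A θ i j) (n : ℕ)
    (i j : Fin 2) : Measurable fun θ => coc T A n θ i j := by
  induction n generalizing i j with
  | zero => exact measurable_const
  | succ n ih =>
    simp only [coc, Matrix.mul_apply, Fin.sum_univ_two]
    exact (((ih i 0).comp hT).mul (hA 0 j)).add (((ih i 1).comp hT).mul (hA 1 j))

lemma measurable_log_fro {M : Θ → Matrix (Fin 2) (Fin 2) ℝ}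
    (hM : ∀ i j, Measurable fun θ => M θ i j) : Measurable fun θ => Real.log (fro (M θ)) := by
  have h00 := hM 0 0
  have h01 := hM 0 1
  have h10 := hM 1 0
  have h11 := hM 1 1
  unfold fro
  fun_prop

lemma integrable_log_fro_coc [IsFiniteMeasure m] (hT : Measurable T)
    (hA : ∀ i j, Measurable fun θ => A θ i j) (hdet : ∀ θ, (A θ).det = 1)
    (hC : ∀ θ, fro (A θ) ≤ C) (n : ℕ) :
    Integrable (fun θ => Real.log (fro (coc T A n θ))) m := by
  refine Integrable.of_bound (measurable_log_fro (measurable_coc hT hA n)).aestronglyMeasurable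
    ((Real.log C + Real.log 2) * (n + 1)) (.of_forall fun θ => ?_)
  rw [Real.norm_eq_abs, abs_of_nonneg (log_fro_nonneg (det_coc hdet n θ))]
  exact log_fro_coc_le hdet hC n θ

/-- A positive mean growth rate of a matrix cocycle over an ergodic map forces exponential growth
along almost every orbit. -/
lemma ae_eventually_le_log_fro_coc [IsProbabilityMeasure m] (herg : Ergodic T m)
    (hA : ∀ i j, Measurable fun θ => A θ i j) (hdet : ∀ θ, (A θ).det = 1)
    (hC : ∀ θ, fro (A θ) ≤ C) {lam : ℝ} (hpos : 0 < lam)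
    (hlam : Tendsto (fun n : ℕ => (∫ θ, Real.log (fro (coc T A n θ)) ∂m) / n) atTop (𝓝 lam)) :
    ∀ᵐ θ ∂m, ∀ᶠ n : ℕ in atTop, lam / 3 * n ≤ Real.log (fro (coc T A n θ)) := by
  have hT := herg.toMeasurePreserving
  have hmeas := fun n => measurable_log_fro (measurable_coc hT.measurable hA n)
  have hint := fun n => integrable_log_fro_coc (m := m) hT.measurable hA hdet hC n
  set E : Set Θ := {θ | ∃ j : ℕ, ∃ᶠ n : ℕ in atTop,
    Real.log (fro (coc T A n θ)) ≤ lam / 3 * n + j} with hE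
  have hEmeas : MeasurableSet E := by
    simp only [hE, frequently_atTop, ofPred_exists, ofPred_forall, ofPred_and]
    exact MeasurableSet.iUnion fun j => MeasurableSet.iInter fun a => MeasurableSet.iUnion fun b =>
      (MeasurableSet.const _).inter (measurableSet_le (hmeas b) measurable_const)
  have hsubset : E ⊆ T ⁻¹' E := by
    rintro θ ⟨j, hj⟩
    obtain ⟨k, hk⟩ := exists_nat_ge (j + Real.log C + lam / 3)
    refine ⟨k, ?_⟩
    rw [frequently_atTop] at hj ⊢
    intro a
    obtain ⟨b, hb, hb'⟩ := hj (a + 1)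
    obtain ⟨b, rfl⟩ : ∃ b', b = b' + 1 := ⟨b - 1, by omega⟩
    refine ⟨b, by omega, ?_⟩
    have := log_fro_coc_comp_le (T := T) hdet hC b θ
    push_cast at hb'
    linarith
  rcases herg.ae_empty_or_univ_of_ae_le_preimage hEmeas.nullMeasurableSet
    hsubset.eventuallyLE with h | h
  · filter_upwards [h.mem_iff] with θ hθ
    have : θ ∉ E := fun h' => hθ.1 h'
    simp only [hE, mem_ofPred_eq, not_exists, not_frequently, not_le] at this
    filter_upwards [this 0] with n hn
    push_cast at hn
    linarith
  · exfalso
    obtain ⟨θ₀⟩ : Nonempty Θ := m.nonempty_of_neZero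
    have hC1 := one_le_of_fro_le hdet hC θ₀
    have hK : 0 ≤ Real.log C + Real.log 2 :=
      add_nonneg (Real.log_nonneg hC1) (Real.log_nonneg one_le_two)
    have := growth_rate_nonpos (f := fun n θ => Real.log (fro (coc T A n θ)) - lam / 2 * n)
      (L := lam - lam / 2) hT hK ?_ ?_ ?_ ?_ ?_ ?_
    · linarith
    · intro n θ
      have : 0 ≤ lam / 2 * n := by positivity
      linarith [log_fro_coc_le (T := T) hdet hC n θ]
    · intro a b θ
      have := log_fro_mul_le (det_coc (T := T) hdet b (T^[a] θ)) (det_coc (T := T) hdet a θ)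
      rw [← coc_add] at this
      push_cast
      linarith
    · exact fun n => (hmeas n).sub_const _
    · exact fun n => (hint n).sub (integrable_const _)
    · filter_upwards [h.mem_iff] with θ hθ
      obtain ⟨j, hj⟩ := hθ.2 trivial
      obtain ⟨N, hN⟩ := exists_nat_ge (j / (lam / 6))
      obtain ⟨n, hn, hn'⟩ := frequently_atTop.1 hj (N + 1)
      refine ⟨n, by omega, ?_⟩
      rw [div_le_iff₀ (by positivity)] at hN
      have : (N : ℝ) ≤ n := by exact_mod_cast (by omega : N ≤ n)
      nlinarith
    · refine (hlam.sub_const (lam / 2)).congr' ?_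
      filter_upwards [eventually_gt_atTop 0] with n hn
      have hn' : (n : ℝ) ≠ 0 := by exact_mod_cast hn.ne'
      rw [integral_sub (hint n) (integrable_const _)]
      simp
      field_simp

end Cocycle

section ContractedDirection

variable {M B : ℕ → Matrix (Fin 2) (Fin 2) ℝ} {C c : ℝ}

lemma fro_pos {N : Matrix (Fin 2) (Fin 2) ℝ} (h : N.det = 1) : 0 < fro N :=
  zero_lt_one.trans_le (one_le_fro h)

lemma summable_contrUnit_defect (hM : ∀ n, (M n).det = 1) (hc : 0 < c)
    (hgrowth : ∀ᶠ n : ℕ in atTop, c * n ≤ Real.log (fro (M n))) :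
    Summable fun n => 8 * C ^ 2 / fro (M n) ^ 2 := by
  have hgeom : Summable fun n : ℕ => 8 * C ^ 2 * Real.exp (-(2 * c)) ^ n :=
    (summable_geometric_of_lt_one (Real.exp_pos _).le
      (Real.exp_lt_one_iff.2 (by linarith))).mul_left _
  refine hgeom.of_norm_bounded_eventually_nat ?_
  filter_upwards [hgrowth] with n hn
  have hpos := fro_pos (hM n)
  rw [Real.norm_eq_abs, abs_of_nonneg (by positivity), div_eq_mul_inv]
  gcongr
  rw [← Real.exp_nat_mul, inv_le_comm₀ (by positivity) (Real.exp_pos _), ← Real.exp_neg,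
    ← Real.le_log_iff_exp_le (by positivity), Real.log_pow]
  push_cast
  linarith

lemma dist_contrUnit_sq_le (hM : ∀ n, (M n).det = 1) (hB : ∀ n, (B n).det = 1)
    (hMB : ∀ n, M (n + 1) = B n * M n) (hC : ∀ n, fro (B n) ≤ C) (n : ℕ) :
    dist (contrUnit (M n) ^ 2) (contrUnit (M n.succ) ^ 2) ≤ 8 * C ^ 2 / fro (M n) ^ 2 := by
  rw [dist_eq_norm, norm_sq_sub_sq (norm_contrUnit (hM n)) (norm_contrUnit (hM _)),
    Nat.succ_eq_add_one, hMB]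
  have h1 := abs_wedge_contrUnit_contrUnit_le (hM n) (hB n)
  have hpos := fro_pos (hM n)
  have h2 : 4 * fro (B n) ^ 2 / fro (M n) ^ 2 ≤ 4 * C ^ 2 / fro (M n) ^ 2 := by
    have := fro_nonneg (B n)
    gcongr
    exact hC n
  calc _ ≤ 2 * (4 * C ^ 2 / fro (M n) ^ 2) := by linarith
    _ = _ := by ring

lemma exists_tendsto_contrUnit_sq (hM : ∀ n, (M n).det = 1) (hB : ∀ n, (B n).det = 1)
    (hMB : ∀ n, M (n + 1) = B n * M n) (hC : ∀ n, fro (B n) ≤ C) (hc : 0 < c)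
    (hgrowth : ∀ᶠ n : ℕ in atTop, c * n ≤ Real.log (fro (M n))) :
    ∃ l, Tendsto (fun n => contrUnit (M n) ^ 2) atTop (𝓝 l) :=
  cauchySeq_tendsto_of_complete (cauchySeq_of_dist_le_of_summable _
    (dist_contrUnit_sq_le hM hB hMB hC) (summable_contrUnit_defect hM hc hgrowth))

variable {s v : ℂ}

lemma tendsto_abs_wedge_contrUnit (hM : ∀ n, (M n).det = 1) (hs : ‖s‖ = 1)
    (hlim : Tendsto (fun n => contrUnit (M n) ^ 2) atTop (𝓝 (s ^ 2))) (hv : ‖v‖ = 1) :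
    Tendsto (fun n => |wedge v (contrUnit (M n))|) atTop (𝓝 |wedge v s|) := by
  have h := ((tendsto_const_nhds (x := v ^ 2)).sub hlim).norm.div_const 2
  rw [norm_sq_sub_sq hv hs] at h
  simp only [norm_sq_sub_sq hv (norm_contrUnit (hM _))] at h
  simpa using h

lemma tendsto_norm_actC_div_fro (hM : ∀ n, (M n).det = 1) (hc : 0 < c)
    (hgrowth : ∀ᶠ n : ℕ in atTop, c * n ≤ Real.log (fro (M n))) (hs : ‖s‖ = 1)
    (hlim : Tendsto (fun n => contrUnit (M n) ^ 2) atTop (𝓝 (s ^ 2))) :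
    Tendsto (fun n => ‖actC (M n) s‖ / fro (M n)) atTop (𝓝 0) := by
  have h1 := tendsto_abs_wedge_contrUnit hM hs hlim hs
  have h2 := ((summable_contrUnit_defect (C := 1) hM hc hgrowth).tendsto_atTop_zero).const_mul
    (1 / 4)
  have h3 := h2.add h1
  have : wedge s s = 0 := by simp [wedge]; ring
  rw [this, abs_zero, mul_zero, add_zero] at h3
  refine squeeze_zero (fun n => div_nonneg (norm_nonneg _) (fro_nonneg _)) (fun n => ?_) h3
  have hpos := fro_pos (hM n)
  rw [div_le_iff₀ hpos]
  refine (norm_actC_le_of_contrUnit (hM n) hs).trans (le_of_eq ?_)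
  field_simp
  ring

lemma wedge_eq_zero_of_tendsto (hM : ∀ n, (M n).det = 1) (hs : ‖s‖ = 1)
    (hlim : Tendsto (fun n => contrUnit (M n) ^ 2) atTop (𝓝 (s ^ 2))) (hv : ‖v‖ = 1)
    (h : Tendsto (fun n => ‖actC (M n) v‖ / fro (M n)) atTop (𝓝 0)) : wedge v s = 0 := by
  have h1 := tendsto_abs_wedge_contrUnit hM hs hlim hv
  have h2 := h.const_mul 2
  rw [mul_zero] at h2
  refine abs_nonpos_iff.1 (le_of_tendsto_of_tendsto' h1 h2 fun n => ?_)
  rw [← mul_div_assoc]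
  exact abs_wedge_contrUnit_le (hM n) v

lemma isBigO_inv_norm_actC (hM : ∀ n, (M n).det = 1)
    (hgrowth : ∀ᶠ n : ℕ in atTop, c * n ≤ Real.log (fro (M n))) (hs : ‖s‖ = 1)
    (hlim : Tendsto (fun n => contrUnit (M n) ^ 2) atTop (𝓝 (s ^ 2))) (hv : ‖v‖ = 1)
    (h : wedge v s ≠ 0) :
    (fun n => ‖actC (M n) v‖⁻¹) =O[atTop] fun n : ℕ => Real.exp (-c * n) := by
  set e := |wedge v s| / 2 with he
  have hepos : 0 < e := by positivity
  have h1 := (tendsto_abs_wedge_contrUnit hM hs hlim hv).eventually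
    (lt_mem_nhds (show e < |wedge v s| by linarith))
  refine Asymptotics.IsBigO.of_bound (2 / e) ?_
  filter_upwards [h1, hgrowth] with n hn hg
  have h2 := hn.le.trans (abs_wedge_contrUnit_le (hM n) v)
  have hpos := fro_pos (hM n)
  rw [le_div_iff₀ hpos] at h2
  rw [Real.le_log_iff_exp_le hpos] at hg
  rw [norm_inv, norm_norm, Real.norm_eq_abs, Real.abs_exp, neg_mul, Real.exp_neg,
    ← div_eq_mul_inv, div_div]
  have hexp := Real.exp_pos (c * n)
  have h3 : e * Real.exp (c * n) ≤ 2 * ‖actC (M n) v‖ := by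
    refine le_trans ?_ h2
    gcongr
  rw [inv_eq_one_div, div_le_div_iff₀ (by nlinarith [mul_pos hepos hexp]) (by positivity)]
  linarith

lemma exists_log_norm_actC_le (hM : ∀ n, (M n).det = 1) (hB : ∀ n, (B n).det = 1)
    (hMB : ∀ n, M (n + 1) = B n * M n) (hC : ∀ n, fro (B n) ≤ C) (hc : 0 < c)
    (hgrowth : ∀ᶠ n : ℕ in atTop, c * n ≤ Real.log (fro (M n))) (hs : ‖s‖ = 1)
    (hlim : Tendsto (fun n => contrUnit (M n) ^ 2) atTop (𝓝 (s ^ 2))) :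
    ∃ n, 1 ≤ n ∧ Real.log ‖actC (M n) s‖ ≤ -(c / 2) * n := by
  have hr : Real.exp (-c) < 1 := Real.exp_lt_one_iff.2 (by linarith)
  set K := 2 + 4 * C ^ 2 * (1 - Real.exp (-c))⁻¹ with hK
  have hKpos : 0 < K := by
    have : 0 < (1 - Real.exp (-c))⁻¹ := inv_pos.2 (by linarith)
    positivity
  obtain ⟨N₁, hN₁⟩ := exists_nat_ge (Real.log K / (c / 2))
  obtain ⟨N₂, hN₂⟩ := eventually_atTop.1 hgrowth
  set N := N₁ + N₂ + 1 with hN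
  set t : ℕ → ℝ := fun k => Real.log (fro (M k)) - c / 2 * k with ht
  have htlim : Tendsto t atTop atTop := by
    refine tendsto_atTop_mono' _ ?_
      (tendsto_natCast_atTop_atTop.const_mul_atTop (show 0 < c / 2 by positivity))
    filter_upwards [hgrowth] with n hn
    simp only [ht]
    linarith
  obtain ⟨k, hk⟩ := Filter.Tendsto.exists_forall_le (f := fun k => t (k + N))
    (by rw [Nat.cofinite_eq_atTop]; exact (tendsto_add_atTop_iff_nat N).2 htlim)
  set n := k + N with hn
  have hpos := fro_pos (hM n)
  have hfro : ∀ j, 8 * C ^ 2 / fro (M (n + j)) ^ 2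
      ≤ 8 * C ^ 2 / fro (M n) ^ 2 * Real.exp (-c) ^ j := fun j => by
    have h1 := hk (k + j)
    have h2 : k + j + N = n + j := by omega
    simp only [h2, ht] at h1
    push_cast at h1
    have hpos' := fro_pos (hM (n + j))
    have h3 : fro (M n) * Real.exp (c / 2 * j) ≤ fro (M (n + j)) := by
      rw [← Real.log_le_log_iff (by positivity) hpos', Real.log_mul hpos.ne' (Real.exp_pos _).ne',
        Real.log_exp]
      linarith
    have h4 : (fro (M n) * Real.exp (c / 2 * j)) ^ 2 ≤ fro (M (n + j)) ^ 2 := by gcongr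
    have h5 : Real.exp (c / 2 * j) ^ 2 = (Real.exp (-c) ^ j)⁻¹ := by
      rw [← Real.exp_nat_mul, ← Real.exp_nat_mul, ← Real.exp_neg]
      congr 1
      push_cast
      ring
    rw [mul_pow, h5] at h4
    calc _ ≤ 8 * C ^ 2 / (fro (M n) ^ 2 * (Real.exp (-c) ^ j)⁻¹) := by gcongr
      _ = _ := by field_simp
  have hsum := summable_contrUnit_defect (C := C) hM hc hgrowth
  have hgeom := summable_geometric_of_lt_one (Real.exp_pos (-c)).le hr
  have hdist := dist_le_tsum_of_dist_le_of_tendsto _ (dist_contrUnit_sq_le hM hB hMB hC) hsum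
    hlim n
  have hdist2 : ∑' j, 8 * C ^ 2 / fro (M (n + j)) ^ 2
      ≤ 8 * C ^ 2 / fro (M n) ^ 2 * (1 - Real.exp (-c))⁻¹ := by
    rw [← tsum_geometric_of_lt_one (Real.exp_pos (-c)).le hr, ← tsum_mul_left]
    refine Summable.tsum_le_tsum hfro ?_ (hgeom.mul_left _)
    simpa only [add_comm] using (summable_nat_add_iff n).2 hsum
  rw [dist_comm, dist_eq_norm, norm_sq_sub_sq hs (norm_contrUnit (hM n))] at hdist
  have hle : ‖actC (M n) s‖ ≤ K / fro (M n) := by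
    refine (norm_actC_le_of_contrUnit (hM n) hs).trans ?_
    have h1 : |wedge s (contrUnit (M n))|
        ≤ 4 * C ^ 2 / fro (M n) ^ 2 * (1 - Real.exp (-c))⁻¹ := by
      have : 8 * C ^ 2 / fro (M n) ^ 2 * (1 - Real.exp (-c))⁻¹
        = 2 * (4 * C ^ 2 / fro (M n) ^ 2 * (1 - Real.exp (-c))⁻¹) := by ring
      linarith
    calc _ ≤ 2 / fro (M n) + fro (M n) * (4 * C ^ 2 / fro (M n) ^ 2 * (1 - Real.exp (-c))⁻¹) := by
          gcongr
      _ = _ := by rw [hK]; field_simp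
  have hs0 : s ≠ 0 := by rintro rfl; simp at hs
  have hlog := Real.log_le_log (norm_pos_iff.2 (actC_ne_zero (hM n) hs0)) hle
  rw [Real.log_div hKpos.ne' hpos.ne'] at hlog
  refine ⟨n, by omega, ?_⟩
  have h6 := hN₂ n (by omega)
  rw [div_le_iff₀ (by positivity)] at hN₁
  have h7 : (N₁ : ℝ) ≤ n := by exact_mod_cast (by omega : N₁ ≤ n)
  nlinarith

end ContractedDirection

section InvariantGraph

lemma sq_dir_fract_arg {l : ℂ} (hl : ‖l‖ = 1) :
    dir (Int.fract (Complex.arg l / (2 * Real.pi))) ^ 2 = l := by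
  obtain ⟨ε, hε, h⟩ := dir_fract (Complex.arg l / (2 * Real.pi))
  have hε2 : ε * ε = 1 := by rw [← abs_mul_abs_self, hε, one_mul]
  have hx : Real.pi * (Complex.arg l / (2 * Real.pi)) = Complex.arg l / 2 := by field_simp
  have hl0 : l ≠ 0 := by rintro rfl; simp at hl
  have hre := Complex.cos_arg hl0
  have him := Complex.sin_arg l
  rw [hl, div_one] at hre him
  have harg : l.arg = 2 * (l.arg / 2) := by ring
  rw [h, smul_pow, pow_two ε, hε2, one_smul]
  rw [harg] at hre him
  rw [Real.cos_two_mul] at hre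
  rw [Real.sin_two_mul] at him
  apply Complex.ext
  · simp only [pow_two, dir, hx, Complex.mul_re]
    linear_combination hre - Real.cos_sq_add_sin_sq (l.arg / 2)
  · simp only [pow_two, dir, hx, Complex.mul_im]
    linear_combination him

variable {Θ : Type*} {T : Θ → Θ} {A : Θ → Matrix (Fin 2) (Fin 2) ℝ} {C : ℝ}

lemma exists_dir_eq_smul_of_ang_eq {N : Matrix (Fin 2) (Fin 2) ℝ} (hN : N.det = 1) {α β : ℝ}
    (h : ang (actC N (dir α)) = β) :
    ∃ r : ℝ, r ≠ 0 ∧ |r| = ‖actC N (dir α)‖ ∧ actC N (dir α) = r • dir β := by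
  obtain ⟨r, hr0, hr⟩ := wedge_eq_zero_of_ang_eq (actC_ne_zero hN (dir_ne_zero α)) h
  refine ⟨r, hr0, ?_, hr⟩
  rw [hr, norm_smul, norm_dir, mul_one, Real.norm_eq_abs]

lemma abs_log_norm_actC_dir_le (hdet : ∀ θ, (A θ).det = 1) (hC : ∀ θ, fro (A θ) ≤ C) (θ : Θ)
    (α : ℝ) : |Real.log ‖actC (A θ) (dir α)‖| ≤ Real.log C := by
  have h1 := norm_actC_le (A θ) (dir α)
  have h2 := norm_le_fro_mul_norm_actC (hdet θ) (dir α)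
  have h3 := norm_pos_iff.2 (actC_ne_zero (hdet θ) (dir_ne_zero α))
  have hf := fro_pos (hdet θ)
  rw [norm_dir] at h1 h2
  rw [mul_one] at h1
  have h4 := Real.log_le_log h3 (h1.trans (hC θ))
  have h5 := Real.log_le_log one_pos h2
  have h6 := Real.log_le_log hf (hC θ)
  rw [Real.log_mul hf.ne' h3.ne', Real.log_one] at h5
  exact abs_le.2 ⟨by linarith, h4⟩

lemma birkhoffSum_log_norm_actC (hdet : ∀ θ, (A θ).det = 1) {φ : Θ → ℝ} (n : ℕ) {θ : Θ}
    (hφ : ∀ k, ang (actC (A (T^[k] θ)) (dir (φ (T^[k] θ)))) = φ (T^[k + 1] θ)) :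
    birkhoffSum T (fun θ => Real.log ‖actC (A θ) (dir (φ θ))‖) n θ
      = Real.log ‖actC (coc T A n θ) (dir (φ θ))‖ := by
  induction n generalizing θ with
  | zero => simp [coc, actC_one, norm_dir]
  | succ n ih =>
    obtain ⟨r, hr0, hr1, hr⟩ := exists_dir_eq_smul_of_ang_eq (hdet θ) (hφ 0)
    simp only [Function.iterate_zero, id_eq, zero_add, Function.iterate_one] at hr hr1
    rw [birkhoffSum_succ', ih fun k => hφ (k + 1), coc, actC_mul, ← hr1, hr, actC_smul, norm_smul,
      Real.norm_eq_abs, Real.log_mul (abs_ne_zero.2 hr0)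
      (norm_pos_iff.2 (actC_ne_zero (det_coc hdet n _) (dir_ne_zero _))).ne']

variable [MeasurableSpace Θ] {m : Measure Θ}

lemma measurable_complex_mk {f g : Θ → ℝ} (hf : Measurable f) (hg : Measurable g) :
    Measurable fun θ => (⟨f θ, g θ⟩ : ℂ) := by
  have : (fun θ => (⟨f θ, g θ⟩ : ℂ)) = fun θ => (f θ : ℂ) + g θ * Complex.I := by
    ext θ
    exact Complex.mk_eq_add_mul_I _ _
  rw [this]
  fun_prop

lemma measurable_dir : Measurable dir :=
  measurable_complex_mk (by fun_prop) (by fun_prop)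

lemma measurable_actC {z : Θ → ℂ} (hA : ∀ i j, Measurable fun θ => A θ i j) (hz : Measurable z) :
    Measurable fun θ => actC (A θ) (z θ) := by
  have h00 := hA 0 0
  have h01 := hA 0 1
  have h10 := hA 1 0
  have h11 := hA 1 1
  exact measurable_complex_mk (by fun_prop) (by fun_prop)

lemma measurable_contrUnit (hA : ∀ i j, Measurable fun θ => A θ i j) :
    Measurable fun θ => contrUnit (A θ) := by
  have h00 := hA 0 0
  have h01 := hA 0 1
  have h10 := hA 1 0
  have h11 := hA 1 1
  have : Measurable fun θ => contr (A θ) :=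
    Measurable.ite (measurableSet_le (by fun_prop) (by fun_prop))
      (measurable_complex_mk h11 h10.neg) (measurable_complex_mk h01.neg h00)
  exact this.norm.inv.smul this

/-- Existence of the stable direction of a matrix cocycle with positive Lyapunov exponent. -/
lemma exists_stable_graph [IsProbabilityMeasure m] (herg : Ergodic T m)
    (hA : ∀ i j, Measurable fun θ => A θ i j) (hdet : ∀ θ, (A θ).det = 1)
    (hC : ∀ θ, fro (A θ) ≤ C) {lam : ℝ} (hpos : 0 < lam)
    (hlam : Tendsto (fun n : ℕ => (∫ θ, Real.log (fro (coc T A n θ)) ∂m) / n) atTop (𝓝 lam)) :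
    ∃ φ : Θ → ℝ, Measurable φ ∧ (∀ θ, φ θ ∈ Ico (0 : ℝ) 1) ∧
      (∀ᵐ θ ∂m, ang (actC (A θ) (dir (φ θ))) = φ (T θ)) ∧
      (∀ᵐ θ ∂m, ∀ v, ‖v‖ = 1 → wedge v (dir (φ θ)) ≠ 0 → ∃ κ : ℝ, 0 < κ ∧
        (fun n => ‖actC (coc T A n θ) v‖⁻¹) =O[atTop] fun n : ℕ => Real.exp (-κ * n)) ∧
      ∫ θ, Real.log ‖actC (A θ) (dir (φ θ))‖ ∂m < 0 := by
  have hT := herg.toMeasurePreserving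
  have hTm := hT.measurable
  set c := lam / 3 with hc_def
  have hc : 0 < c := by positivity
  have hgrowth := ae_eventually_le_log_fro_coc herg hA hdet hC hpos hlam
  have hz : ∀ n, Measurable fun θ => contrUnit (coc T A n θ) ^ 2 := fun n =>
    (measurable_contrUnit (measurable_coc hTm hA n)).pow_const 2
  have hexists : ∀ᵐ θ ∂m, ∃ l, Tendsto (fun n => contrUnit (coc T A n θ) ^ 2) atTop (𝓝 l) := by
    filter_upwards [hgrowth] with θ hθ
    exact exists_tendsto_contrUnit_sq (det_coc hdet · θ) (fun n => hdet _) (coc_succ' · θ)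
      (fun n => hC _) hc hθ
  obtain ⟨l, hlmeas, hl⟩ := measurable_limit_of_tendsto_metrizable_ae
    (fun n => (hz n).aemeasurable) hexists
  set φ : Θ → ℝ := fun θ => Int.fract (Complex.arg (l θ) / (2 * Real.pi)) with hφ
  have hφmeas : Measurable φ := (hlmeas.carg.div_const _).fract
  have hlim : ∀ᵐ θ ∂m, Tendsto (fun n => contrUnit (coc T A n θ) ^ 2) atTop
      (𝓝 (dir (φ θ) ^ 2)) := by
    filter_upwards [hl] with θ hθ
    have h1 : ‖l θ‖ = 1 := by
      refine tendsto_nhds_unique hθ.norm ?_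
      simp [norm_contrUnit (det_coc hdet _ θ)]
    rwa [hφ, sq_dir_fract_arg h1]
  have hmem : ∀ θ, φ θ ∈ Ico (0 : ℝ) 1 := fun θ => ⟨Int.fract_nonneg _, Int.fract_lt_one _⟩
  have hinv : ∀ᵐ θ ∂m, ang (actC (A θ) (dir (φ θ))) = φ (T θ) := by
    filter_upwards [hlim, hgrowth, hT.quasiMeasurePreserving.ae hlim] with θ h1 h2 h3
    have hM : ∀ n, (coc T A n θ).det = 1 := (det_coc hdet · θ)
    have hM' : ∀ n, (coc T A n (T θ)).det = 1 := (det_coc hdet · (T θ))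
    have hne := actC_ne_zero (hdet θ) (dir_ne_zero (φ θ))
    obtain ⟨r, hr0, hr⟩ := dir_ang hne
    refine eq_of_coe_eq_coe (ang_mem _) (hmem _) (coe_eq_coe_of_wedge_eq_zero ?_)
    refine wedge_eq_zero_of_tendsto hM' (norm_dir _) h3 (norm_dir _) ?_
    have h4 := (tendsto_add_atTop_iff_nat 1).2 (tendsto_norm_actC_div_fro hM hc h2 (norm_dir _) h1)
    have h5 := h4.const_mul (|r| * C)
    rw [mul_zero] at h5
    refine squeeze_zero (fun n => div_nonneg (norm_nonneg _) (fro_nonneg _)) (fun n => ?_) h5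
    have h6 : fro (coc T A (n + 1) θ) ≤ C * fro (coc T A n (T θ)) := by
      rw [coc, mul_comm C]
      exact (fro_mul_le _ _).trans (by gcongr; exacts [fro_nonneg _, hC θ])
    have hp1 := fro_pos (hM (n + 1))
    have hp2 := fro_pos (hM' n)
    rw [hr, actC_smul, norm_smul, Real.norm_eq_abs, ← actC_mul, ← coc, ← mul_div_assoc,
      div_le_div_iff₀ hp2 hp1]
    calc _ ≤ |r| * ‖actC (coc T A (n + 1) θ) (dir (φ θ))‖ * (C * fro (coc T A n (T θ))) := by
          gcongr
      _ = _ := by ring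
  refine ⟨φ, hφmeas, hmem, hinv, ?_, ?_⟩
  · filter_upwards [hlim, hgrowth] with θ h1 h2 v hv hvs
    exact ⟨c, hc, isBigO_inv_norm_actC (det_coc hdet · θ) h2 (norm_dir _) h1 hv hvs⟩
  set ψ : Θ → ℝ := fun θ => Real.log ‖actC (A θ) (dir (φ θ))‖ with hψ
  have hψmeas : Measurable ψ := (measurable_actC hA (measurable_dir.comp hφmeas)).norm.log
  have hψbound : ∀ θ, |ψ θ| ≤ Real.log C := fun θ => abs_log_norm_actC_dir_le hdet hC θ _
  have hψint : Integrable ψ m :=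
    Integrable.of_bound hψmeas.aestronglyMeasurable _ (.of_forall hψbound)
  obtain ⟨θ₀⟩ : Nonempty Θ := m.nonempty_of_neZero
  have hlogC : 0 ≤ Real.log C := (abs_nonneg _).trans (hψbound θ₀)
  have horbit : ∀ᵐ θ ∂m, ∀ k,
      ang (actC (A (T^[k] θ)) (dir (φ (T^[k] θ)))) = φ (T^[k + 1] θ) := by
    rw [ae_all_iff]
    intro k
    filter_upwards [(hT.iterate k).quasiMeasurePreserving.ae hinv] with θ hθ
    rw [hθ, Function.iterate_succ_apply']
  have hsum_le : ∀ (n : ℕ) θ, birkhoffSum T ψ n θ ≤ n * Real.log C := fun n θ => by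
    refine (Finset.sum_le_card_nsmul _ _ (Real.log C) fun k _ =>
      (le_abs_self _).trans (hψbound _)).trans ?_
    simp
  have key := growth_rate_nonpos (f := fun n θ => birkhoffSum T ψ n θ + c / 2 * n)
    (K := Real.log C + c / 2) (L := ∫ θ, ψ θ ∂m + c / 2) hT (by positivity) ?_ ?_ ?_ ?_ ?_ ?_
  · linarith
  · intro n θ
    nlinarith [hsum_le n θ]
  · intro a b θ
    rw [birkhoffSum_add]
    push_cast
    linarith
  · intro n
    refine Measurable.add_const ?_ _
    exact Finset.measurable_fun_sum _ fun k _ => hψmeas.comp (hTm.iterate k)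
  · exact fun n => (integrable_birkhoffSum hT hψint n).add (integrable_const _)
  · filter_upwards [hlim, hgrowth, horbit] with θ h1 h2 h3
    obtain ⟨n, hn1, hn⟩ := exists_log_norm_actC_le (det_coc hdet · θ) (fun n => hdet _)
      (coc_succ' · θ) (fun n => hC _) hc h2 (norm_dir _) h1
    refine ⟨n, hn1, ?_⟩
    rw [hψ, birkhoffSum_log_norm_actC hdet n h3]
    linarith
  · refine tendsto_const_nhds.congr' ?_
    filter_upwards [eventually_gt_atTop 0] with n hn
    have hn' : (n : ℝ) ≠ 0 := by exact_mod_cast hn.ne'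
    rw [integral_add (integrable_birkhoffSum hT hψint n) (integrable_const _),
      integral_birkhoffSum hT hψint]
    simp
    field_simp

end InvariantGraph

section Transfer

lemma norm_eq_norm_complex (v : R2) : ‖v‖ = ‖(⟨v 0, v 1⟩ : ℂ)‖ := by
  rw [← sq_eq_sq₀ (norm_nonneg _) (norm_nonneg _), sq_norm_eq, EuclideanSpace.norm_sq_eq]
  simp

lemma norm_toEuclideanCLM (M : Matrix (Fin 2) (Fin 2) ℝ) (v : R2) :
    ‖(Matrix.toEuclideanCLM (𝕜 := ℝ) M : R2 →L[ℝ] R2) v‖ = ‖actC M ⟨v 0, v 1⟩‖ := by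
  rw [norm_eq_norm_complex]
  simp [actC, Matrix.mulVec, dotProduct, Fin.sum_univ_two]

lemma opNorm_le_fro (M : Matrix (Fin 2) (Fin 2) ℝ) : opNorm M ≤ fro M :=
  ContinuousLinearMap.opNorm_le_bound _ (fro_nonneg M) fun v => by
    rw [norm_toEuclideanCLM, norm_eq_norm_complex v]
    exact norm_actC_le _ _

lemma norm_actC_le_opNorm (M : Matrix (Fin 2) (Fin 2) ℝ) (z : ℂ) :
    ‖actC M z‖ ≤ opNorm M * ‖z‖ := by
  have := ContinuousLinearMap.le_opNorm
    (Matrix.toEuclideanCLM (𝕜 := ℝ) M : R2 →L[ℝ] R2) (!₂[z.re, z.im] : R2)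
  rw [norm_toEuclideanCLM, norm_eq_norm_complex] at this
  simpa [opNorm] using this

lemma fro_le_two_mul_opNorm (M : Matrix (Fin 2) (Fin 2) ℝ) : fro M ≤ 2 * opNorm M := by
  have h0 : 0 ≤ opNorm M := norm_nonneg _
  have h1 := norm_actC_le_opNorm M 1
  have h2 := norm_actC_le_opNorm M Complex.I
  rw [norm_one, mul_one] at h1
  rw [Complex.norm_I, mul_one] at h2
  have h1' := pow_le_pow_left₀ (norm_nonneg _) h1 2
  have h2' := pow_le_pow_left₀ (norm_nonneg _) h2 2
  rw [sq_norm_eq] at h1' h2'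
  simp only [actC, Complex.one_re, Complex.one_im, Complex.I_re, Complex.I_im, mul_one, mul_zero,
    add_zero, zero_add] at h1' h2'
  apply le_of_sq_le_sq _ (by positivity)
  rw [sq_fro]
  nlinarith

lemma abs_log_fro_sub_log_opNorm_le {M : Matrix (Fin 2) (Fin 2) ℝ} (h : M.det = 1) :
    |Real.log (fro M) - Real.log (opNorm M)| ≤ Real.log 2 := by
  have hf := fro_pos h
  have h2 := fro_le_two_mul_opNorm M
  have ho : 0 < opNorm M := by linarith
  have h3 := Real.log_le_log hf h2
  have h4 := Real.log_le_log ho (opNorm_le_fro M)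
  rw [Real.log_mul two_ne_zero ho.ne'] at h3
  exact abs_le.2 ⟨by linarith [Real.log_nonneg one_le_two], by linarith⟩

lemma continuous_opNorm : Continuous opNorm := by
  have : Continuous (Matrix.toEuclideanCLM (n := Fin 2) (𝕜 := ℝ)).toAlgEquiv.toLinearMap :=
    LinearMap.continuous_of_finiteDimensional _
  exact this.norm

variable {Θ : Type*}

lemma gMap_eq (T : Θ → Θ) (A : Θ → Matrix (Fin 2) (Fin 2) ℝ) (θ : Θ) (α : ℝ) :
    gMap T A (θ, α) = (T θ, ang (actC (A θ) (dir α))) := by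
  have h : ∀ i, mulVecE (A θ) (vHalf α) i = A θ i 0 * (dir α).re + A θ i 1 * (dir α).im := by
    simp [mulVecE, vHalf, dir]
  simp only [gMap, projAngle, ang, actC, h, Complex.mk_eq_add_mul_I]

variable {T : Θ → Θ} {A : Θ → Matrix (Fin 2) (Fin 2) ℝ}

lemma actC_coc_eq_smul_dir_gMap (hdet : ∀ θ, (A θ).det = 1) (n : ℕ) (θ : Θ) (α : ℝ) :
    ∃ r : ℝ, actC (coc T A n θ) (dir α) = r • dir ((gMap T A)^[n] (θ, α)).2 := by
  induction n generalizing θ α with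
  | zero => exact ⟨1, by simp [coc, actC_one]⟩
  | succ n ih =>
    obtain ⟨r, -, -, hr⟩ := exists_dir_eq_smul_of_ang_eq (hdet θ) (α := α) rfl
    obtain ⟨r', hr'⟩ := ih (T θ) (ang (actC (A θ) (dir α)))
    refine ⟨r * r', ?_⟩
    rw [coc, actC_mul, hr, actC_smul, hr', Function.iterate_succ_apply, gMap_eq, smul_smul]

lemma dist_gMap_le (hdet : ∀ θ, (A θ).det = 1) (n : ℕ) (θ : Θ) (α β : ℝ) :
    dist (((gMap T A)^[n] (θ, α)).2 : AddCircle (1 : ℝ)) ((gMap T A)^[n] (θ, β)).2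
      ≤ ‖actC (coc T A n θ) (dir α)‖⁻¹ * ‖actC (coc T A n θ) (dir β)‖⁻¹ := by
  obtain ⟨r, hr⟩ := actC_coc_eq_smul_dir_gMap (T := T) hdet n θ α
  obtain ⟨r', hr'⟩ := actC_coc_eq_smul_dir_gMap (T := T) hdet n θ β
  have hM := det_coc (T := T) hdet n θ
  have hn := norm_pos_iff.2 (actC_ne_zero hM (dir_ne_zero α))
  have hn' := norm_pos_iff.2 (actC_ne_zero hM (dir_ne_zero β))
  have hw := (wedge_actC hM (dir α) (dir β)).symm
  have hle := abs_wedge_le (dir α) (dir β)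
  rw [norm_dir, norm_dir, mul_one, hw, hr, hr', wedge_smul_left, wedge_smul_right, abs_mul,
    abs_mul] at hle
  rw [hr, norm_smul, norm_dir, mul_one, Real.norm_eq_abs] at hn ⊢
  rw [hr', norm_smul, norm_dir, mul_one, Real.norm_eq_abs] at hn' ⊢
  have h2 := two_mul_dist_le_abs_wedge ((gMap T A)^[n] (θ, α)).2 ((gMap T A)^[n] (θ, β)).2
  have h3 : |wedge (dir ((gMap T A)^[n] (θ, α)).2) (dir ((gMap T A)^[n] (θ, β)).2)|
      ≤ |r|⁻¹ * |r'|⁻¹ := by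
    rw [← mul_inv, ← one_div, le_div_iff₀ (by positivity)]
    linarith
  have h4 := abs_nonneg (wedge (dir ((gMap T A)^[n] (θ, α)).2) (dir ((gMap T A)^[n] (θ, β)).2))
  linarith

lemma iterate_gMap_of_invariant {φ : Θ → ℝ} {θ : Θ}
    (hφ : ∀ k, (gMap T A (T^[k] θ, φ (T^[k] θ))).2 = φ (T^[k + 1] θ)) (n : ℕ) :
    (gMap T A)^[n] (θ, φ θ) = (T^[n] θ, φ (T^[n] θ)) := by
  induction n with
  | zero => rfl
  | succ n ih =>
    rw [Function.iterate_succ_apply', ih]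
    exact Prod.ext (Function.iterate_succ_apply' T n θ).symm (hφ n)

lemma coc_symm (γ : Θ ≃ Θ) (n : ℕ) (θ : Θ) :
    coc γ.symm (fun θ => (A (γ.symm θ))⁻¹) n θ = (coc γ A n (γ.symm^[n] θ))⁻¹ := by
  induction n generalizing θ with
  | zero => simp [coc]
  | succ n ih =>
    have : γ^[n] (γ.symm^[n] (γ.symm θ)) = γ.symm θ :=
      (Function.LeftInverse.iterate γ.apply_symm_apply n) _
    rw [coc, ih, ← Matrix.mul_inv_rev, coc_succ', Function.iterate_succ_apply, this]

variable [MeasurableSpace Θ] {m : Measure Θ}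

lemma measurable_inv_entry (hA : ∀ i j, Measurable fun θ => A θ i j)
    (hdet : ∀ θ, (A θ).det = 1) (i j : Fin 2) : Measurable fun θ => (A θ)⁻¹ i j := by
  have : ∀ θ, (A θ)⁻¹ = !![A θ 1 1, -A θ 0 1; -A θ 1 0, A θ 0 0] := fun θ => by
    rw [Matrix.inv_def, hdet θ, ← Matrix.adjugate_fin_two]; simp
  simp only [this]
  fin_cases i <;> fin_cases j
  · exact hA 1 1
  · exact (hA 0 1).neg
  · exact (hA 1 0).neg
  · exact hA 0 0

lemma tendsto_integral_log_fro [IsProbabilityMeasure m] (hT : Measurable T)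
    (hA : ∀ i j, Measurable fun θ => A θ i j) (hdet : ∀ θ, (A θ).det = 1) {C : ℝ}
    (hC : ∀ θ, fro (A θ) ≤ C) {lam : ℝ}
    (hlam : Tendsto (fun n : ℕ => (∫ θ, Real.log (opNorm (coc T A n θ)) ∂m) / n) atTop (𝓝 lam)) :
    Tendsto (fun n : ℕ => (∫ θ, Real.log (fro (coc T A n θ)) ∂m) / n) atTop (𝓝 lam) := by
  have hbound : ∀ n, ∀ᵐ θ ∂m, ‖Real.log (fro (coc T A n θ)) - Real.log (opNorm (coc T A n θ))‖
      ≤ Real.log 2 := fun n => .of_forall fun θ =>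
    abs_log_fro_sub_log_opNorm_le (det_coc hdet n θ)
  have hmeas : ∀ n, Measurable fun θ => Real.log (opNorm (coc T A n θ)) := fun n =>
    ((show Continuous fun M : Fin 2 → Fin 2 → ℝ => opNorm (Matrix.of M) from
      continuous_opNorm).measurable.comp (measurable_pi_iff.2 fun i => measurable_pi_iff.2 fun j =>
      measurable_coc hT hA n i j)).log
  have hint := fun n => integrable_log_fro_coc (m := m) hT hA hdet hC n
  have hdiff : ∀ n, Integrable (fun θ => Real.log (fro (coc T A n θ))
      - Real.log (opNorm (coc T A n θ))) m := fun n =>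
    Integrable.of_bound ((hint n).aestronglyMeasurable.sub (hmeas n).aestronglyMeasurable) _
      (hbound n)
  have hzero : Tendsto (fun n : ℕ => (∫ θ, (Real.log (fro (coc T A n θ))
      - Real.log (opNorm (coc T A n θ))) ∂m) / n) atTop (𝓝 0) := by
    refine squeeze_zero_norm (fun n => ?_) (tendsto_const_div_atTop_nhds_zero_nat (Real.log 2))
    rw [norm_div, Real.norm_natCast]
    gcongr
    simpa using norm_integral_le_of_norm_le_const (hbound n)
  have := hlam.add hzero
  rw [add_zero] at this
  refine this.congr fun n => ?_
  have hop : Integrable (fun θ => Real.log (opNorm (coc T A n θ))) m :=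
    ((hint n).sub (hdiff n)).congr (.of_forall fun θ => by simp)
  rw [integral_sub (hint n) hop]
  ring

lemma ae_forall_iterate_invariant (hT : MeasurePreserving T m m) {φ : Θ → ℝ}
    (hφ : ∀ᵐ θ ∂m, (gMap T A (θ, φ θ)).2 = φ (T θ)) :
    ∀ᵐ θ ∂m, ∀ k, (gMap T A (T^[k] θ, φ (T^[k] θ))).2 = φ (T^[k + 1] θ) := by
  rw [ae_all_iff]
  intro k
  filter_upwards [(hT.iterate k).quasiMeasurePreserving.ae hφ] with θ hθ
  rw [hθ, Function.iterate_succ_apply']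

/-- Two invariant graphs over an ergodic base coincide a.e. or differ a.e. -/
lemma ae_eq_or_ae_ne (herg : Ergodic T m) [IsFiniteMeasure m] {φ ψ : Θ → ℝ} (hφ : Measurable φ)
    (hψ : Measurable ψ) (hφinv : ∀ᵐ θ ∂m, (gMap T A (θ, φ θ)).2 = φ (T θ))
    (hψinv : ∀ᵐ θ ∂m, (gMap T A (θ, ψ θ)).2 = ψ (T θ)) :
    (∀ᵐ θ ∂m, φ θ = ψ θ) ∨ ∀ᵐ θ ∂m, φ θ ≠ ψ θ := by
  have hle : {θ | φ θ = ψ θ} ≤ᵐ[m] T ⁻¹' {θ | φ θ = ψ θ} := by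
    filter_upwards [hφinv, hψinv] with θ h1 h2
    intro (h : φ θ = ψ θ)
    change φ (T θ) = ψ (T θ)
    rw [← h1, ← h2, h]
  rcases herg.ae_empty_or_univ_of_ae_le_preimage (measurableSet_eq_fun hφ hψ).nullMeasurableSet
    hle with h | h
  · right
    filter_upwards [h.mem_iff] with θ hθ h'
    exact hθ.1 h'
  · left
    filter_upwards [h.mem_iff] with θ hθ
    exact hθ.2 trivial

/-- A measurable function on a finite measure-preserving system that tends to zero along a.e. orbit
is a.e. nonpositive. -/
lemma ae_nonpos_of_tendsto_zero [IsFiniteMeasure m] (hT : MeasurePreserving T m m) {h : Θ → ℝ}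
    (hmeas : Measurable h) (hlim : ∀ᵐ θ ∂m, Tendsto (fun n => h (T^[n] θ)) atTop (𝓝 0)) :
    ∀ᵐ θ ∂m, h θ ≤ 0 := by
  have hrec : ∀ k : ℕ, ∀ᵐ θ ∂m, 1 / ((k : ℝ) + 1) < h θ →
      ∃ᶠ n in atTop, 1 / ((k : ℝ) + 1) < h (T^[n] θ) := fun k =>
    hT.conservative.ae_mem_imp_frequently_image_mem
      (measurableSet_lt measurable_const hmeas).nullMeasurableSet
  filter_upwards [hlim, ae_all_iff.2 hrec] with θ h1 h2
  by_contra! hpos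
  obtain ⟨k, hk⟩ := exists_nat_one_div_lt hpos
  obtain ⟨n, hn, hn'⟩ := ((h2 k hk).and_eventually
    (h1.eventually (gt_mem_nhds (show 0 < 1 / ((k : ℝ) + 1) by positivity)))).exists
  exact absurd hn (not_lt.2 hn'.le)

end Transfer

/-- If `λ_m(A) > 0`, there are measurable (g,m)-invariant graphs
`φ_u, φ_s : Θ → 𝕋` (here with values in the fundamental domain [0,1) ⊆ ℝ) such that
for m-a.e. θ, every `α ≠ φ_s(θ)` is attracted to `φ_u` with exponential speed, and
every (g,m)-invariant graph coincides m-a.e. with `φ_u` or `φ_s`. -/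
theorem stmt12 {Θ : Type*} [MeasurableSpace Θ]
    (γ : Θ ≃ Θ) (hγ : Measurable ⇑γ) (hγ' : Measurable ⇑γ.symm)
    (m : Measure Θ) [IsProbabilityMeasure m] (herg : Ergodic ⇑γ m)
    (A : Θ → Matrix (Fin 2) (Fin 2) ℝ) (hdet : ∀ θ, (A θ).det = 1)
    (hAmeas : ∀ i j, Measurable fun θ => A θ i j)
    (hAbdd : ∃ C : ℝ, ∀ θ, opNorm (A θ) ≤ C)
    (lam : ℝ)
    (hlam : Filter.Tendsto
      (fun n : ℕ => (∫ θ, Real.log (opNorm (coc ⇑γ A n θ)) ∂m) / n)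
      Filter.atTop (𝓝 lam))
    (hpos : 0 < lam) :
    ∃ φu φs : Θ → ℝ, Measurable φu ∧ Measurable φs ∧
      (∀ θ, φu θ ∈ Set.Ico (0 : ℝ) 1) ∧ (∀ θ, φs θ ∈ Set.Ico (0 : ℝ) 1) ∧
      (∀ᵐ θ ∂m, (gMap ⇑γ A (θ, φu θ)).2 = φu (γ θ)) ∧
      (∀ᵐ θ ∂m, (gMap ⇑γ A (θ, φs θ)).2 = φs (γ θ)) ∧
      (∀ᵐ θ ∂m, ∀ α : ℝ,
        ((α : AddCircle (1 : ℝ)) ≠ ((φs θ : ℝ) : AddCircle (1 : ℝ))) →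
        ∃ C : ℝ, 0 < C ∧ ∃ lam' : ℝ, 0 < lam' ∧ ∀ n : ℕ,
          dist ((((gMap ⇑γ A)^[n] (θ, α)).2 : AddCircle (1 : ℝ)))
              ((φu ((⇑γ)^[n] θ) : AddCircle (1 : ℝ))) ≤ C * Real.exp (-lam' * n)) ∧
      (∀ ψ : Θ → ℝ, Measurable ψ → (∀ θ, ψ θ ∈ Set.Ico (0 : ℝ) 1) →
        (∀ᵐ θ ∂m, (gMap ⇑γ A (θ, ψ θ)).2 = ψ (γ θ)) →
        ((∀ᵐ θ ∂m, ψ θ = φu θ) ∨ (∀ᵐ θ ∂m, ψ θ = φs θ))) := by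
  obtain ⟨C₀, hC₀⟩ := hAbdd
  have hC : ∀ θ, fro (A θ) ≤ 2 * C₀ := fun θ =>
    (fro_le_two_mul_opNorm _).trans (by linarith [hC₀ θ])
  have hT := herg.toMeasurePreserving
  have hlam' := tendsto_integral_log_fro hγ hAmeas hdet hC hlam
  set e : Θ ≃ᵐ Θ := ⟨γ, hγ, hγ'⟩
  have herg' : Ergodic γ.symm m := Ergodic.symm (e := e) herg
  set B : Θ → Matrix (Fin 2) (Fin 2) ℝ := fun θ => (A (γ.symm θ))⁻¹
  have hBdet : ∀ θ, (B θ).det = 1 := fun θ => det_inv_eq_one (hdet _)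
  have hBmeas : ∀ i j, Measurable fun θ => B θ i j := fun i j =>
    (measurable_inv_entry hAmeas hdet i j).comp hγ'
  have hBC : ∀ θ, fro (B θ) ≤ 2 * C₀ := fun θ => by
    simp only [B]
    rw [fro_inv (hdet _)]
    exact hC _
  have hBlam : Tendsto (fun n : ℕ => (∫ θ, Real.log (fro (coc γ.symm B n θ)) ∂m) / n) atTop
      (𝓝 lam) := by
    refine hlam'.congr fun n => ?_
    have : ∀ θ, Real.log (fro (coc γ.symm B n θ)) = Real.log (fro (coc γ A n (γ.symm^[n] θ))) :=
      fun θ => by rw [coc_symm, fro_inv (det_coc hdet _ _)]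
    simp only [this]
    rw [integral_comp_measurePreserving (herg'.toMeasurePreserving.iterate n)
      (integrable_log_fro_coc hγ hAmeas hdet hC n).aestronglyMeasurable]
  obtain ⟨φs, hφs, hφs_mem, hφs_inv, hφs_exp, hφs_int⟩ :=
    exists_stable_graph herg hAmeas hdet hC hpos hlam'
  obtain ⟨φu, hφu, hφu_mem, hφu_inv, -, hφu_int⟩ :=
    exists_stable_graph herg' hBmeas hBdet hBC hpos hBlam
  have hinv : ∀ᵐ θ ∂m, ang (actC (A θ) (dir (φu θ))) = φu (γ θ) := by
    filter_upwards [hT.quasiMeasurePreserving.ae hφu_inv] with θ hθ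
    simp only [B, Equiv.symm_apply_apply] at hθ
    obtain ⟨r, -, -, hr⟩ := exists_dir_eq_smul_of_ang_eq (det_inv_eq_one (hdet θ)) hθ
    refine ang_eq_of_wedge_eq_zero (actC_ne_zero (hdet θ) (dir_ne_zero _)) (hφu_mem _) ?_
    rw [← actC_actC_inv (hdet θ) (dir (φu (γ θ))), wedge_actC (hdet θ), hr, wedge_smul_left]
    simp only [wedge]
    ring
  have hs' : ∀ᵐ θ ∂m, (gMap γ A (θ, φs θ)).2 = φs (γ θ) := by simpa only [gMap_eq] using hφs_inv
  have hu' : ∀ᵐ θ ∂m, (gMap γ A (θ, φu θ)).2 = φu (γ θ) := by simpa only [gMap_eq] using hinv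
  have hne : ∀ᵐ θ ∂m, φu θ ≠ φs θ := by
    refine (ae_eq_or_ae_ne herg hφu hφs hu' hs').resolve_left fun heq => ?_
    have h1 : ∀ᵐ θ ∂m, Real.log ‖actC (B (γ θ)) (dir (φu (γ θ)))‖
        = -Real.log ‖actC (A θ) (dir (φs θ))‖ := by
      filter_upwards [heq, hinv] with θ h2 h3
      obtain ⟨r, hr0, hr1, hr⟩ := exists_dir_eq_smul_of_ang_eq (hdet θ) h3
      have h4 := actC_inv_actC (hdet θ) (dir (φu θ))
      rw [hr, actC_smul] at h4
      have h5 := congrArg norm h4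
      rw [norm_smul, norm_dir, Real.norm_eq_abs, hr1, mul_comm] at h5
      simp only [B, Equiv.symm_apply_apply]
      rw [← h2, eq_inv_of_mul_eq_one_left h5, Real.log_inv]
    have hm : Measurable fun θ => Real.log ‖actC (B θ) (dir (φu θ))‖ :=
      (measurable_actC hBmeas (measurable_dir.comp hφu)).norm.log
    have h2 := integral_comp_measurePreserving hT hm.aestronglyMeasurable
    rw [integral_congr_ae h1, integral_neg] at h2
    linarith
  have hattr : ∀ᵐ θ ∂m, ∀ α : ℝ,
      ((α : AddCircle (1 : ℝ)) ≠ ((φs θ : ℝ) : AddCircle (1 : ℝ))) →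
      ∃ C : ℝ, 0 < C ∧ ∃ lam' : ℝ, 0 < lam' ∧ ∀ n : ℕ,
        dist ((((gMap ⇑γ A)^[n] (θ, α)).2 : AddCircle (1 : ℝ)))
          ((φu ((⇑γ)^[n] θ) : AddCircle (1 : ℝ))) ≤ C * Real.exp (-lam' * n) := by
    filter_upwards [hφs_exp, hne, ae_forall_iterate_invariant hT hu'] with θ h1 h2 h3 α hα
    obtain ⟨κ, hκ, hO⟩ := h1 (dir α) (norm_dir α) fun h => hα (coe_eq_coe_of_wedge_eq_zero h)
    obtain ⟨κ', hκ', hO'⟩ := h1 (dir (φu θ)) (norm_dir _) fun h =>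
      h2 (eq_of_coe_eq_coe (hφu_mem _) (hφs_mem _) (coe_eq_coe_of_wedge_eq_zero h))
    obtain ⟨K, hK, hbound⟩ := Asymptotics.bound_of_isBigO_nat_atTop (hO.mul hO')
    refine ⟨K, hK, κ + κ', add_pos hκ hκ', fun n => ?_⟩
    have h4 := dist_gMap_le (T := γ) hdet n θ α (φu θ)
    rw [iterate_gMap_of_invariant h3] at h4
    refine h4.trans ((le_abs_self _).trans ((hbound (x := n) (by positivity)).trans ?_))
    rw [← Real.exp_add, Real.norm_eq_abs, Real.abs_exp]
    refine le_of_eq ?_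
    ring_nf
  refine ⟨φu, φs, hφu, hφs, hφu_mem, hφs_mem, hu', hs', hattr, fun ψ hψ hψ_mem hψ_inv => ?_⟩
  refine (ae_eq_or_ae_ne herg hψ hφs hψ_inv hs').symm.imp_left fun hψs => ?_
  have hd : Measurable fun θ =>
      dist ((ψ θ : ℝ) : AddCircle (1 : ℝ)) ((φu θ : ℝ) : AddCircle (1 : ℝ)) :=
    (AddCircle.measurable_mk'.comp hψ).dist (AddCircle.measurable_mk'.comp hφu)
  have hd0 := ae_nonpos_of_tendsto_zero hT hd ?_
  · filter_upwards [hd0] with θ hθ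
    exact eq_of_coe_eq_coe (hψ_mem θ) (hφu_mem θ) (dist_le_zero.1 hθ)
  · filter_upwards [hattr, hψs, ae_forall_iterate_invariant hT hψ_inv] with θ h1 h2 h3
    obtain ⟨K, -, κ, hκ, hK⟩ := h1 (ψ θ) fun h => h2 (eq_of_coe_eq_coe (hψ_mem _) (hφs_mem _) h)
    simp only [iterate_gMap_of_invariant h3] at hK
    refine squeeze_zero (fun n => dist_nonneg) hK ?_
    have hexp : Tendsto (fun n : ℕ => Real.exp (-κ * n)) atTop (𝓝 0) :=
      Real.tendsto_exp_atBot.comp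
        (tendsto_natCast_atTop_atTop.const_mul_atTop_of_neg (neg_lt_zero.2 hκ))
    simpa using hexp.const_mul K
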